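/- Let k ∈ ℕ and ξ ∈ ℝ. For n ∈ ℕ define r_n = ((log n + ((3k)/2 − 1)·log(log n) + ξ)/(π·n))^{1/3} and a_n(t) = (π/3)·(2·r_n³ + 3·r_n²·t − t³). Then the sequence of integrals ∫₀^{r_n/2} (2t/(π·(r_n² − t²)²)) · exp(−n·a_n(t)) · Σ_{i=0}^{k} (n·a_n(t))^i / i! dt converges to 0 as n → ∞. -/

import Mathlib

open Real Filter MeasureTheory

/-- A truncated exponential series is at most `(k + 1) y ^ k` when its argument is at most `y`. -/
lemma sum_range_pow_div_factorial_le (k : ℕ) {x y : ℝ} (hx : 0 ≤ x) (hxy : x ≤ y) (hy : 1 ≤ y) :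
    ∑ i ∈ Finset.range (k + 1), x ^ i / (Nat.factorial i) ≤ (k + 1) * y ^ k := by
  have h : ∀ i ∈ Finset.range (k + 1), x ^ i / (Nat.factorial i : ℝ) ≤ y ^ k := fun i hi => by
    have hf : (1 : ℝ) ≤ Nat.factorial i := by exact_mod_cast Nat.factorial_pos i
    calc x ^ i / (Nat.factorial i : ℝ) ≤ x ^ i := div_le_self (by positivity) hf
      _ ≤ y ^ i := by gcongr
      _ ≤ y ^ k := pow_le_pow_right₀ hy (by simpa [Nat.lt_succ_iff] using hi)
  simpa using Finset.sum_le_card_nsmul _ _ _ h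

/-- Pointwise bound for the error term, in terms of `L = π n r³`. -/
lemma error_integrand_le (k : ℕ) {n r t L : ℝ} (hn : 0 < n) (hr : 0 < r) (hL : 1 ≤ L)
    (hLr : L = π * n * r ^ 3) (ht : 0 ≤ t) (htr : t ≤ r / 2) :
    ‖(2 * t / (π * (r ^ 2 - t ^ 2) ^ 2)) *
        Real.exp (-(n * (π / 3 * (2 * r ^ 3 + 3 * r ^ 2 * t - t ^ 3)))) *
        ∑ i ∈ Finset.range (k + 1),
          (n * (π / 3 * (2 * r ^ 3 + 3 * r ^ 2 * t - t ^ 3))) ^ i / (Nat.factorial i)‖ ≤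
      (k + 1) * (2 * L) ^ k * Real.exp (-(2 / 3 * L)) / (n * r ^ 6) := by
  have hpi : (3 : ℝ) < π := pi_gt_three
  set c : ℝ := 3 / 4 * π * n * r ^ 2 with hc
  have hc0 : 0 < c := by positivity
  set x : ℝ := n * (π / 3 * (2 * r ^ 3 + 3 * r ^ 2 * t - t ^ 3)) with hx
  have hsq : t ^ 2 ≤ r ^ 2 / 4 := by nlinarith
  have hlow : 2 / 3 * L + c * t ≤ x := by
    have h : 9 / 4 * r ^ 2 * t ≤ 3 * r ^ 2 * t - t ^ 3 := by nlinarith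
    have := mul_le_mul_of_nonneg_left h (show 0 ≤ n * (π / 3) by positivity)
    rw [hx, hLr, hc]; linarith
  have hup : x ≤ 2 * L := by
    have h : 3 * r ^ 2 * t - t ^ 3 ≤ 4 * r ^ 3 := by
      have : 0 ≤ t ^ 3 := by positivity
      nlinarith [mul_le_mul_of_nonneg_left htr (sq_nonneg r), pow_pos hr 3]
    have := mul_le_mul_of_nonneg_left h (show 0 ≤ n * (π / 3) by positivity)
    rw [hx, hLr]; linarith
  have hx0 : 0 ≤ x := le_trans (by positivity) hlow
  have hsum := sum_range_pow_div_factorial_le k hx0 hup (by linarith)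
  have hden : π * (9 / 16 * r ^ 4) ≤ π * (r ^ 2 - t ^ 2) ^ 2 := by
    have : (3 / 4 * r ^ 2) ^ 2 ≤ (r ^ 2 - t ^ 2) ^ 2 :=
      pow_le_pow_left₀ (by positivity) (by linarith) 2
    gcongr
    linarith
  have hexp : t * Real.exp (-x) ≤ Real.exp (-(2 / 3 * L)) / c := by
    have h1 : Real.exp (-x) ≤ Real.exp (-(2 / 3 * L)) * Real.exp (-(c * t)) := by
      rw [← Real.exp_add]; exact Real.exp_le_exp.2 (by linarith)
    have h2 : c * t * Real.exp (-(c * t)) ≤ 1 := by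
      rw [Real.exp_neg, ← div_eq_mul_inv, div_le_one (Real.exp_pos _)]
      linarith [Real.add_one_le_exp (c * t)]
    rw [le_div_iff₀ hc0]
    calc t * Real.exp (-x) * c
        ≤ t * (Real.exp (-(2 / 3 * L)) * Real.exp (-(c * t))) * c := by gcongr
      _ = Real.exp (-(2 / 3 * L)) * (c * t * Real.exp (-(c * t))) := by ring
      _ ≤ Real.exp (-(2 / 3 * L)) * 1 := by gcongr
      _ = _ := mul_one _
  have hS0 : 0 ≤ ∑ i ∈ Finset.range (k + 1), x ^ i / (Nat.factorial i : ℝ) :=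
    Finset.sum_nonneg fun i _ => by positivity
  rw [Real.norm_of_nonneg (by positivity)]
  have hcoef : 2 / (π * (9 / 16 * r ^ 4)) / c ≤ 1 / (n * r ^ 6) := by
    rw [div_div, hc]
    have h9 : 9 ≤ π * π := by nlinarith
    rw [div_le_div_iff₀ (by positivity) (by positivity)]
    have := mul_le_mul_of_nonneg_right h9 (show 0 ≤ n * r ^ 6 by positivity)
    nlinarith [show 0 < n * r ^ 6 by positivity]
  calc 2 * t / (π * (r ^ 2 - t ^ 2) ^ 2) * Real.exp (-x) *
        ∑ i ∈ Finset.range (k + 1), x ^ i / (Nat.factorial i : ℝ)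
      ≤ 2 * t / (π * (9 / 16 * r ^ 4)) * Real.exp (-x) * ((k + 1) * (2 * L) ^ k) := by gcongr
    _ = 2 / (π * (9 / 16 * r ^ 4)) * (t * Real.exp (-x)) * ((k + 1) * (2 * L) ^ k) := by ring
    _ ≤ 2 / (π * (9 / 16 * r ^ 4)) * (Real.exp (-(2 / 3 * L)) / c) *
        ((k + 1) * (2 * L) ^ k) := by gcongr
    _ = 2 / (π * (9 / 16 * r ^ 4)) / c * ((k + 1) * (2 * L) ^ k * Real.exp (-(2 / 3 * L))) := by
        ring
    _ ≤ 1 / (n * r ^ 6) * ((k + 1) * (2 * L) ^ k * Real.exp (-(2 / 3 * L))) := by gcongr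
    _ = _ := by ring

/-- Bound for the error integral, in terms of `L = π n r³`. -/
lemma norm_error_integral_le (k : ℕ) {n r L : ℝ} (hn : 0 < n) (hr : 0 < r) (hL : 1 ≤ L)
    (hLr : L = π * n * r ^ 3) :
    ‖∫ t in (0 : ℝ)..(r / 2), (2 * t / (π * (r ^ 2 - t ^ 2) ^ 2)) *
        Real.exp (-(n * (π / 3 * (2 * r ^ 3 + 3 * r ^ 2 * t - t ^ 3)))) *
        ∑ i ∈ Finset.range (k + 1),
          (n * (π / 3 * (2 * r ^ 3 + 3 * r ^ 2 * t - t ^ 3))) ^ i / (Nat.factorial i)‖ ≤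
      (k + 1) * (2 * L) ^ k * Real.exp (-(2 / 3 * L)) / (n * r ^ 5) := by
  refine (intervalIntegral.norm_integral_le_of_norm_le_const fun t ht => ?_).trans
    (b := (k + 1) * (2 * L) ^ k * Real.exp (-(2 / 3 * L)) / (n * r ^ 6) * |r / 2 - 0|) ?_
  · rw [Set.uIoc_of_le (by positivity)] at ht
    exact error_integrand_le k hn hr hL hLr ht.1.le ht.2
  · rw [sub_zero, abs_of_pos (by positivity)]
    calc (k + 1) * (2 * L) ^ k * Real.exp (-(2 / 3 * L)) / (n * r ^ 6) * (r / 2)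
        = (k + 1) * (2 * L) ^ k * Real.exp (-(2 / 3 * L)) / (n * r ^ 5) / 2 := by field_simp
      _ ≤ _ := half_le_self (by positivity)

/-- The bound of `norm_error_integral_le`, rewritten with `ℓ = log n`. -/
lemma error_bound_eq (k : ℕ) {ξ n ℓ L r : ℝ} (hn : 0 < n) (hℓn : ℓ = Real.log n) (hℓ : 0 < ℓ)
    (hL : L = ℓ + (3 * (k : ℝ) / 2 - 1) * Real.log ℓ + ξ) (hL0 : 0 < L)
    (hr : r = (L / (π * n)) ^ ((1 : ℝ) / 3)) :
    (k + 1) * (2 * L) ^ k * Real.exp (-(2 / 3 * L)) / (n * r ^ 5) =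
      (k + 1) * 2 ^ k * π ^ (5 / 3 : ℝ) * Real.exp (-(2 / 3 * ξ)) *
        ((L / ℓ) ^ ((k : ℝ) - 5 / 3) * ℓ⁻¹) := by
  have hr5 : r ^ 5 = (L / (π * n)) ^ (5 / 3 : ℝ) := by
    rw [hr, ← Real.rpow_natCast, ← Real.rpow_mul (by positivity)]; norm_num
  have hne : n = Real.exp ℓ := by rw [hℓn, Real.exp_log hn]
  have h1 : (L / (π * n)) ^ (5 / 3 : ℝ) =
      Real.exp (5 / 3 * Real.log L) / (π ^ (5 / 3 : ℝ) * Real.exp (5 / 3 * ℓ)) := by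
    rw [Real.div_rpow hL0.le (by positivity), Real.mul_rpow pi_pos.le hn.le,
      Real.rpow_def_of_pos hL0, Real.rpow_def_of_pos hn, ← hℓn, mul_comm ℓ, mul_comm (Real.log L)]
  have h2 : (L / ℓ) ^ ((k : ℝ) - 5 / 3) * ℓ⁻¹ =
      Real.exp (((k : ℝ) - 5 / 3) * (Real.log L - Real.log ℓ) - Real.log ℓ) := by
    rw [Real.rpow_def_of_pos (by positivity), Real.log_div hL0.ne' hℓ.ne', Real.exp_sub,
      Real.exp_log hℓ, mul_comm (Real.log L - _), ← div_eq_mul_inv]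
  have h3 : L ^ k = Real.exp (k * Real.log L) := by
    rw [← Real.rpow_natCast, Real.rpow_def_of_pos hL0, mul_comm]
  have hpi : 0 < π ^ (5 / 3 : ℝ) := by positivity
  rw [hr5, h1, h2, mul_pow, h3, hne, div_eq_iff (by positivity)]
  have key : Real.exp (k * Real.log L) * Real.exp (-(2 / 3 * L)) * Real.exp (5 / 3 * ℓ) =
      Real.exp (-(2 / 3 * ξ)) *
        Real.exp (((k : ℝ) - 5 / 3) * (Real.log L - Real.log ℓ) - Real.log ℓ) *
        (Real.exp ℓ * Real.exp (5 / 3 * Real.log L)) := by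
    simp only [← Real.exp_add]
    congr 1
    generalize Real.log L = M
    rw [hL]; ring
  field_simp at key ⊢
  linear_combination key

/-- A logarithmic perturbation of the identity is asymptotic to the identity. -/
lemma tendsto_add_mul_log_add_div_self (b c : ℝ) :
    Tendsto (fun x : ℝ => (x + b * Real.log x + c) / x) atTop (nhds 1) := by
  have h1 : Tendsto (fun x : ℝ => Real.log x / x) atTop (nhds 0) :=
    Real.isLittleO_log_id_atTop.tendsto_div_nhds_zero
  have h2 : Tendsto (fun x : ℝ => x⁻¹) atTop (nhds 0) := tendsto_inv_atTop_zero
  have h := ((h1.const_mul b).add (h2.const_mul c)).const_add 1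
  simp only [mul_zero, add_zero] at h
  refine h.congr' ?_
  filter_upwards [eventually_gt_atTop 0] with x hx
  field_simp
  ring

/-- The error term in the integration by parts:
`∫₀^{r_n/2} (2t/(π(r_n²−t²)²))·e^{−n a_n(t)}·Σ_{i=0}^{k} (n a_n(t))^i/i! dt` converges to `0`. -/
theorem tendsto_error_term_integral_zero (k : ℕ) (ξ : ℝ)
    (r : ℕ → ℝ)
    (hr : ∀ n : ℕ, r n =
      ((Real.log n + (3 * (k : ℝ) / 2 - 1) * Real.log (Real.log n) + ξ) / (π * n)) ^ ((1 : ℝ) / 3))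
    (a : ℕ → ℝ → ℝ)
    (ha : ∀ (n : ℕ) (t : ℝ), a n t = π / 3 * (2 * (r n) ^ 3 + 3 * (r n) ^ 2 * t - t ^ 3)) :
    Tendsto (fun n : ℕ =>
        ∫ t in (0 : ℝ)..(r n / 2),
          (2 * t / (π * ((r n) ^ 2 - t ^ 2) ^ 2)) * Real.exp (-((n : ℝ) * a n t)) *
            ∑ i ∈ Finset.range (k + 1), ((n : ℝ) * a n t) ^ i / (Nat.factorial i))
      atTop (nhds 0) := by
  have hlog : Tendsto (fun n : ℕ => Real.log n) atTop atTop :=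
    Real.tendsto_log_atTop.comp tendsto_natCast_atTop_atTop
  have hratio := tendsto_add_mul_log_add_div_self (3 * (k : ℝ) / 2 - 1) ξ
  have hlim : Tendsto (fun x : ℝ => (k + 1) * 2 ^ k * π ^ (5 / 3 : ℝ) * Real.exp (-(2 / 3 * ξ)) *
      (((x + (3 * (k : ℝ) / 2 - 1) * Real.log x + ξ) / x) ^ ((k : ℝ) - 5 / 3) * x⁻¹))
      atTop (nhds 0) := by
    simpa using ((hratio.rpow_const (Or.inl one_ne_zero)).mul tendsto_inv_atTop_zero).const_mul
      ((k + 1) * 2 ^ k * π ^ (5 / 3 : ℝ) * Real.exp (-(2 / 3 * ξ)))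
  have hlarge : ∀ᶠ x : ℝ in atTop, 1 ≤ x + (3 * (k : ℝ) / 2 - 1) * Real.log x + ξ := by
    filter_upwards [hratio.eventually (lt_mem_nhds (show (1 / 2 : ℝ) < 1 by norm_num)),
      eventually_ge_atTop 2] with x hx hx2
    rw [lt_div_iff₀ (by linarith)] at hx
    linarith
  refine squeeze_zero_norm' ?_ (hlim.comp hlog)
  filter_upwards [hlog.eventually hlarge, hlog.eventually_gt_atTop 0, eventually_gt_atTop 0]
    with n hL hℓ hn
  have hn' : (0 : ℝ) < n := by exact_mod_cast hn
  have hL0 := zero_lt_one.trans_le hL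
  have hpos : 0 < r n := by rw [hr]; positivity
  have hcube : Real.log n + (3 * (k : ℝ) / 2 - 1) * Real.log (Real.log n) + ξ =
      π * n * r n ^ 3 := by
    rw [hr n, ← Real.rpow_natCast, ← Real.rpow_mul (by positivity)]
    norm_num
    field_simp
  simp only [ha, Function.comp_apply]
  rw [← error_bound_eq k hn' rfl hℓ rfl hL0 (hr n)]
  exact norm_error_integral_le k hn' hpos hL hcube
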